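/- Let d ≥ 5 be an integer, let a = (2(d−4) + √(3(d−4)(d−2)))/3, b = 1 + 2√((d−4)/(3(d−2))), ρ* = √(2a/(b−1)), and U(ρ) = arccos((a − bρ²)/(a + ρ²)). Then for every T > 0 the function ψ(t,r) := U(r/(T−t)) is a classical solution of the co-rotational strong-field Skyrme equation on the region {(t,r) : 0 < t < T, 0 < r < ρ*(T−t)}, i.e., (sin²ψ/r²)(∂ₜ²ψ − ∂ᵣ²ψ − ((d−3)/r)∂ᵣψ) + (sin(2ψ)/(2r²))((∂ₜψ)² − (∂ᵣψ)² + (d−2)sin²ψ/r²) = 0 holds pointwise on that region. -/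

import Mathlib

/-- The constant `a` in the blowup profile. -/
noncomputable def sfA (d : ℕ) : ℝ :=
  (2 * ((d : ℝ) - 4) + Real.sqrt (3 * ((d : ℝ) - 4) * ((d : ℝ) - 2))) / 3

/-- The constant `b` in the blowup profile. -/
noncomputable def sfB (d : ℕ) : ℝ :=
  1 + 2 * Real.sqrt (((d : ℝ) - 4) / (3 * ((d : ℝ) - 2)))

/-- The radius `ρ* = √(2a/(b-1))`. -/
noncomputable def sfRhoStar (d : ℕ) : ℝ := Real.sqrt (2 * sfA d / (sfB d - 1))

/-- The blowup profile `U(ρ) = arccos((a - bρ²)/(a + ρ²))`. -/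
noncomputable def sfU (d : ℕ) (ρ : ℝ) : ℝ :=
  Real.arccos ((sfA d - sfB d * ρ ^ 2) / (sfA d + ρ ^ 2))

/-- First partial derivative in time. -/
noncomputable def pdt (ψ : ℝ → ℝ → ℝ) (t r : ℝ) : ℝ := deriv (fun s => ψ s r) t

/-- Second partial derivative in time. -/
noncomputable def pdtt (ψ : ℝ → ℝ → ℝ) (t r : ℝ) : ℝ := deriv (fun s => pdt ψ s r) t

/-- First partial derivative in the radial variable. -/
noncomputable def pdr (ψ : ℝ → ℝ → ℝ) (t r : ℝ) : ℝ := deriv (fun s => ψ t s) r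

/-- Second partial derivative in the radial variable. -/
noncomputable def pdrr (ψ : ℝ → ℝ → ℝ) (t r : ℝ) : ℝ := deriv (fun s => pdr ψ t s) r

/-- The co-rotational strong-field Skyrme equation in `d` space dimensions holds
at the point `(t, r)`. -/
noncomputable def SkyrmeSFEq (d : ℕ) (ψ : ℝ → ℝ → ℝ) (t r : ℝ) : Prop :=
  (Real.sin (ψ t r)) ^ 2 / r ^ 2 *
      (pdtt ψ t r - pdrr ψ t r - ((d : ℝ) - 3) / r * pdr ψ t r)
    + Real.sin (2 * ψ t r) / (2 * r ^ 2) *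
      ((pdt ψ t r) ^ 2 - (pdr ψ t r) ^ 2
        + ((d : ℝ) - 2) * (Real.sin (ψ t r)) ^ 2 / r ^ 2) = 0

open Filter Topology in
/-- First and second derivatives of `arccos ∘ f` where `|f| < 1`. -/
theorem deriv_arccos_comp_and_deriv_deriv {f f' : ℝ → ℝ} {f'' x : ℝ}
    (hf : ∀ y, HasDerivAt f (f' y) y) (hf' : HasDerivAt f' f'' x)
    (h₁ : -1 < f x) (h₂ : f x < 1) :
    deriv (fun y => Real.arccos (f y)) x = -(f' x / √(1 - f x ^ 2)) ∧
    deriv (deriv (fun y => Real.arccos (f y))) x =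
      -(f'' / √(1 - f x ^ 2) + f x * f' x ^ 2 / √(1 - f x ^ 2) ^ 3) := by
  have hd : ∀ y, -1 < f y → f y < 1 →
      deriv (fun y => Real.arccos (f y)) y = -(f' y / √(1 - f y ^ 2)) := by
    intro y hy₁ hy₂
    have h := (Real.hasDerivAt_arccos hy₁.ne' hy₂.ne).comp y (hf y)
    refine h.deriv.trans ?_
    ring
  have hev : deriv (fun y => Real.arccos (f y)) =ᶠ[𝓝 x]
      fun y => -(f' y / √(1 - f y ^ 2)) := by
    have hc := (hf x).continuousAt
    filter_upwards [hc.eventually (lt_mem_nhds h₁), hc.eventually (gt_mem_nhds h₂)]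
      with y hy₁ hy₂ using hd y hy₁ hy₂
  have hpos : 0 < 1 - f x ^ 2 := by nlinarith
  have hs : √(1 - f x ^ 2) ≠ 0 := (Real.sqrt_pos.2 hpos).ne'
  refine ⟨hd x h₁ h₂, hev.deriv_eq.trans ?_⟩
  refine (((hf'.div ((((hf x).pow 2).const_sub 1).sqrt hpos.ne') hs).neg).deriv).trans ?_
  simp only [Pi.pow_apply]
  field_simp
  ring

/-- The profile constants in terms of `c = √((d-4)/(3(d-2)))`. -/
theorem exists_sf_parameter {d : ℕ} (hd : 5 ≤ d) :
    ∃ c : ℝ, 0 < c ∧ ((d : ℝ) - 2) * (1 - 3 * c ^ 2) = 2 ∧ sfB d = 1 + 2 * c ∧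
      sfA d = ((d : ℝ) - 2) * c * (1 + 2 * c) := by
  have hd' : (5 : ℝ) ≤ d := by exact_mod_cast hd
  have hm : 0 < 3 * ((d : ℝ) - 2) := by linarith
  have hn : 0 < (d : ℝ) - 4 := by linarith
  have hq := div_pos hn hm
  have hc2 : √(((d : ℝ) - 4) / (3 * ((d : ℝ) - 2))) ^ 2 * (3 * ((d : ℝ) - 2)) = (d : ℝ) - 4 := by
    rw [Real.sq_sqrt hq.le, div_mul_cancel₀ _ hm.ne']
  have hs : √(3 * ((d : ℝ) - 4) * ((d : ℝ) - 2)) =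
      3 * ((d : ℝ) - 2) * √(((d : ℝ) - 4) / (3 * ((d : ℝ) - 2))) := by
    rw [Real.sqrt_eq_iff_eq_sq (by nlinarith [mul_pos hn hm]) (mul_nonneg hm.le (Real.sqrt_nonneg _))]
    linear_combination -(3 * ((d : ℝ) - 2)) * hc2
  refine ⟨_, Real.sqrt_pos.2 hq, by linear_combination -hc2, rfl, ?_⟩
  rw [sfA, hs]
  linear_combination (-2 / 3) * hc2

/-- The cosine of the self-similar profile, as a function of `τ = T - t` and `r`. -/
noncomputable def sfCos (a b τ r : ℝ) : ℝ := (a * τ ^ 2 - b * r ^ 2) / (a * τ ^ 2 + r ^ 2)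

theorem hasDerivAt_sfCos_time {a r : ℝ} (b T s : ℝ) (ha : 0 < a) (hr : r ≠ 0) :
    HasDerivAt (fun s => sfCos a b (T - s) r)
      (-(2 * a * (1 + b) * r ^ 2 * (T - s) / (a * (T - s) ^ 2 + r ^ 2) ^ 2)) s := by
  have hN : a * (T - s) ^ 2 + r ^ 2 ≠ 0 := by positivity
  have h := (((hasDerivAt_id s).const_sub T).pow 2).const_mul a
  refine ((h.sub_const (b * r ^ 2)).div (h.add_const (r ^ 2)) hN).congr_deriv ?_
  simp only [Pi.pow_apply, id_eq]
  field_simp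
  ring

theorem hasDerivAt_sfCos_time_deriv {a r : ℝ} (b T s : ℝ) (ha : 0 < a) (hr : r ≠ 0) :
    HasDerivAt (fun s => -(2 * a * (1 + b) * r ^ 2 * (T - s) / (a * (T - s) ^ 2 + r ^ 2) ^ 2))
      (2 * a * (1 + b) * r ^ 2 * (r ^ 2 - 3 * a * (T - s) ^ 2) /
        (a * (T - s) ^ 2 + r ^ 2) ^ 3) s := by
  have hN : a * (T - s) ^ 2 + r ^ 2 ≠ 0 := by positivity
  have hτ := (hasDerivAt_id s).const_sub T
  have h := (((hτ.pow 2).const_mul a).add_const (r ^ 2)).pow 2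
  refine (((hτ.const_mul (2 * a * (1 + b) * r ^ 2)).div h (pow_ne_zero 2 hN)).neg).congr_deriv ?_
  simp only [Pi.pow_apply, id_eq]
  field_simp
  ring

theorem hasDerivAt_sfCos_radius {a τ : ℝ} (b r : ℝ) (ha : 0 < a) (hτ : τ ≠ 0) :
    HasDerivAt (fun r => sfCos a b τ r)
      (-(2 * a * (1 + b) * τ ^ 2 * r / (a * τ ^ 2 + r ^ 2) ^ 2)) r := by
  have hN : a * τ ^ 2 + r ^ 2 ≠ 0 := by positivity
  have h := (hasDerivAt_id r).pow 2
  refine (((h.const_mul b).const_sub (a * τ ^ 2)).div (h.const_add (a * τ ^ 2)) hN).congr_deriv ?_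
  simp only [Pi.pow_apply, id_eq]
  field_simp
  ring

theorem hasDerivAt_sfCos_radius_deriv {a τ : ℝ} (b r : ℝ) (ha : 0 < a) (hτ : τ ≠ 0) :
    HasDerivAt (fun r => -(2 * a * (1 + b) * τ ^ 2 * r / (a * τ ^ 2 + r ^ 2) ^ 2))
      (-(2 * a * (1 + b) * τ ^ 2 * (a * τ ^ 2 - 3 * r ^ 2) / (a * τ ^ 2 + r ^ 2) ^ 3)) r := by
  have hN : a * τ ^ 2 + r ^ 2 ≠ 0 := by positivity
  have hr := hasDerivAt_id r
  have h := ((hr.pow 2).const_add (a * τ ^ 2)).pow 2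
  refine (((hr.const_mul (2 * a * (1 + b) * τ ^ 2)).div h (pow_ne_zero 2 hN)).neg).congr_deriv ?_
  simp only [Pi.pow_apply, id_eq]
  field_simp
  ring

/-- The equation `w_tt - w_rr - (d-3)/r w_r = (d-2) w (1 - w²)/r²` for `w = cos ψ`. -/
theorem sfCos_wave_eq {a c n τ r : ℝ} (ha0 : 0 < a) (ha : a = (n - 2) * c * (1 + 2 * c))
    (hn : (n - 2) * (1 - 3 * c ^ 2) = 2) (hτ : 0 < τ) (hr : 0 < r) :
    2 * a * (1 + (1 + 2 * c)) * r ^ 2 * (r ^ 2 - 3 * a * τ ^ 2) / (a * τ ^ 2 + r ^ 2) ^ 3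
      - -(2 * a * (1 + (1 + 2 * c)) * τ ^ 2 * (a * τ ^ 2 - 3 * r ^ 2) / (a * τ ^ 2 + r ^ 2) ^ 3)
      - (n - 3) / r * -(2 * a * (1 + (1 + 2 * c)) * τ ^ 2 * r / (a * τ ^ 2 + r ^ 2) ^ 2) =
    (n - 2) * sfCos a (1 + 2 * c) τ r * (1 - sfCos a (1 + 2 * c) τ r ^ 2) / r ^ 2 := by
  have hN : a * τ ^ 2 + r ^ 2 ≠ 0 := by positivity
  have hw : 1 - sfCos a (1 + 2 * c) τ r ^ 2 =
      4 * (1 + c) * r ^ 2 * (a * τ ^ 2 - c * r ^ 2) / (a * τ ^ 2 + r ^ 2) ^ 2 := by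
    rw [sfCos]
    field_simp
    ring
  rw [hw, sfCos]
  field_simp
  linear_combination 4 * (1 + c) * ((r ^ 4 - 3 * a * r ^ 2 * τ ^ 2) * ha + 2 * a * r ^ 2 * τ ^ 2 * hn)

/-- A wave equation for `w = cos ψ` makes the Skyrme expression vanish, where `q = sin ψ`. -/
theorem skyrme_residual_eq_zero {n r w q wt wtt wr wrr : ℝ} (hr : r ≠ 0) (hq : q ≠ 0)
    (h : wtt - wrr - (n - 3) / r * wr = (n - 2) * w * q ^ 2 / r ^ 2) :
    q ^ 2 / r ^ 2 * (-(wtt / q + w * wt ^ 2 / q ^ 3) - -(wrr / q + w * wr ^ 2 / q ^ 3)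
        - (n - 3) / r * -(wr / q))
      + 2 * q * w / (2 * r ^ 2) * ((-(wt / q)) ^ 2 - (-(wr / q)) ^ 2
        + (n - 2) * q ^ 2 / r ^ 2) = 0 := by
  have e : q ^ 2 / r ^ 2 * (-(wtt / q + w * wt ^ 2 / q ^ 3) - -(wrr / q + w * wr ^ 2 / q ^ 3)
        - (n - 3) / r * -(wr / q))
      + 2 * q * w / (2 * r ^ 2) * ((-(wt / q)) ^ 2 - (-(wr / q)) ^ 2
        + (n - 2) * q ^ 2 / r ^ 2) =
      q / r ^ 2 * ((n - 2) * w * q ^ 2 / r ^ 2 - (wtt - wrr - (n - 3) / r * wr)) := by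
    field_simp
    ring
  rw [e, h, sub_self, mul_zero]

/-- The self-similar profile `ψ(t,r) = U(r/(T-t))` solves the strong-field Skyrme
equation classically inside the cone `{0 < t < T, 0 < r < ρ*(T-t)}`. -/
theorem stmt_0 (d : ℕ) (hd : 5 ≤ d) (T : ℝ) (hT : 0 < T)
    (ψ : ℝ → ℝ → ℝ) (hψ : ∀ t r, ψ t r = sfU d (r / (T - t)))
    (t r : ℝ) (ht0 : 0 < t) (htT : t < T) (hr0 : 0 < r)
    (hr : r < sfRhoStar d * (T - t)) :
    SkyrmeSFEq d ψ t r := by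
  obtain ⟨c, hc, hmc, hb, ha⟩ := exists_sf_parameter hd
  have hm : 0 < (d : ℝ) - 2 := by
    have : (5 : ℝ) ≤ d := by exact_mod_cast hd
    linarith
  have ha0 : 0 < sfA d := by rw [ha]; positivity
  have hτ : 0 < T - t := sub_pos.2 htT
  have hcone : c * r ^ 2 < sfA d * (T - t) ^ 2 := by
    have hρ : sfRhoStar d ^ 2 * c = sfA d := by
      rw [sfRhoStar, hb, Real.sq_sqrt (by rw [add_sub_cancel_left]; positivity)]
      field_simp
      ring
    have h2 : r ^ 2 < (sfRhoStar d * (T - t)) ^ 2 := by gcongr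
    calc c * r ^ 2 < c * (sfRhoStar d * (T - t)) ^ 2 := by gcongr
      _ = sfA d * (T - t) ^ 2 := by linear_combination (T - t) ^ 2 * hρ
  have hw₁ : -1 < sfCos (sfA d) (1 + 2 * c) (T - t) r := by
    rw [sfCos, lt_div_iff₀ (by positivity)]
    linarith
  have hw₂ : sfCos (sfA d) (1 + 2 * c) (T - t) r < 1 := by
    rw [sfCos, div_lt_one (by positivity)]
    nlinarith [mul_pos hc (pow_pos hr0 2), pow_pos hr0 2]
  have hψw : ∀ s < T, ∀ y, ψ s y = Real.arccos (sfCos (sfA d) (1 + 2 * c) (T - s) y) := by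
    intro s hs y
    have hs' : T - s ≠ 0 := (sub_pos.2 hs).ne'
    have hN : sfA d * (T - s) ^ 2 + y ^ 2 ≠ 0 := by positivity
    rw [hψ, sfU, hb, sfCos]
    congr 1
    field_simp
  have hev : (fun s => ψ s r) =ᶠ[nhds t]
      fun s => Real.arccos (sfCos (sfA d) (1 + 2 * c) (T - s) r) := by
    filter_upwards [gt_mem_nhds htT] with s hs using hψw s hs r
  obtain ⟨ht, htt⟩ := deriv_arccos_comp_and_deriv_deriv
    (fun s => hasDerivAt_sfCos_time (1 + 2 * c) T s ha0 hr0.ne')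
    (hasDerivAt_sfCos_time_deriv (1 + 2 * c) T t ha0 hr0.ne') hw₁ hw₂
  obtain ⟨hx, hxx⟩ := deriv_arccos_comp_and_deriv_deriv
    (fun y => hasDerivAt_sfCos_radius (1 + 2 * c) y ha0 hτ.ne')
    (hasDerivAt_sfCos_radius_deriv (1 + 2 * c) r ha0 hτ.ne') hw₁ hw₂
  have e₁ : pdt ψ t r = _ := hev.deriv_eq.trans ht
  have e₂ : pdtt ψ t r = _ := hev.deriv.deriv_eq.trans htt
  have e₃ : pdr ψ t r = _ := (congrArg (deriv · r) (funext (hψw t htT))).trans hx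
  have e₄ : pdrr ψ t r = _ :=
    (congrArg (fun f => deriv (deriv f) r) (funext (hψw t htT))).trans hxx
  rw [SkyrmeSFEq, e₁, e₂, e₃, e₄, Real.sin_two_mul, hψw t htT, Real.sin_arccos,
    Real.cos_arccos hw₁.le hw₂.le]
  have hwave := sfCos_wave_eq ha0 ha hmc hτ hr0
  set w := sfCos (sfA d) (1 + 2 * c) (T - t) r
  have hpos : 0 < 1 - w ^ 2 := by nlinarith
  have hq : √(1 - w ^ 2) ^ 2 = 1 - w ^ 2 := Real.sq_sqrt hpos.le
  have hq0 : √(1 - w ^ 2) ≠ 0 := (Real.sqrt_pos.2 hpos).ne'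
  rw [← hq] at hwave
  generalize √(1 - w ^ 2) = q at *
  exact skyrme_residual_eq_zero hr0.ne' hq0 hwave
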